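/- Let n ≥ 2, q > 2 and p ∈ ℝ with p + q ≥ 1, and let u be a positive classical solution of Δu + |∇u|^q u^p = 0 on all of ℝ^n. Then |∇u(x)|^{q−2} u(x)^{p+1} ≤ 2nq(p+q−1)/(q−2) for every x ∈ ℝ^n. -/

import Mathlib

open scoped BigOperators

/-- The Euclidean Laplacian of `u : ℝⁿ → ℝ`, defined as the sum of the second
partial derivatives in the coordinate directions. -/
noncomputable def elaplacian {n : ℕ} (u : EuclideanSpace ℝ (Fin n) → ℝ)
    (x : EuclideanSpace ℝ (Fin n)) : ℝ :=
  ∑ i : Fin n, fderiv ℝ (fun y => fderiv ℝ u y (EuclideanSpace.single i 1)) x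
    (EuclideanSpace.single i 1)

section Laplacian

open Filter Topology

variable {n : ℕ} {s t v : EuclideanSpace ℝ (Fin n) → ℝ} {x : EuclideanSpace ℝ (Fin n)}

lemma differentiableAt_fderiv_apply (hs : ContDiffAt ℝ 2 s x) (e : EuclideanSpace ℝ (Fin n)) :
    DifferentiableAt ℝ (fun y => fderiv ℝ s y e) x :=
  ((hs.fderiv_right (m := 1) (by norm_num)).differentiableAt (by norm_num)).clm_apply
    (differentiableAt_const e)

lemma eventually_differentiableAt (hs : ContDiffAt ℝ 2 s x) :
    ∀ᶠ y in 𝓝 x, DifferentiableAt ℝ s y :=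
  (hs.eventually (by simp)).mono fun _ hy => hy.differentiableAt (by norm_num)

lemma elaplacian_add (hs : ContDiffAt ℝ 2 s x) (ht : ContDiffAt ℝ 2 t x) :
    elaplacian (fun y => s y + t y) x = elaplacian s x + elaplacian t x := by
  unfold elaplacian
  rw [← Finset.sum_add_distrib]
  refine Finset.sum_congr rfl fun i _ => ?_
  have h : (fun y => fderiv ℝ (fun y => s y + t y) y (EuclideanSpace.single i 1)) =ᶠ[𝓝 x]
      fun y => fderiv ℝ s y (EuclideanSpace.single i 1)
        + fderiv ℝ t y (EuclideanSpace.single i 1) := by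
    filter_upwards [eventually_differentiableAt hs, eventually_differentiableAt ht] with y h1 h2
    rw [fderiv_fun_add h1 h2, add_apply]
  rw [h.fderiv_eq, fderiv_fun_add (differentiableAt_fderiv_apply hs _)
    (differentiableAt_fderiv_apply ht _), add_apply]

lemma elaplacian_const_mul (c : ℝ) (hs : ContDiffAt ℝ 2 s x) :
    elaplacian (fun y => c * s y) x = c * elaplacian s x := by
  unfold elaplacian
  rw [Finset.mul_sum]
  refine Finset.sum_congr rfl fun i _ => ?_
  have h : (fun y => fderiv ℝ (fun y => c * s y) y (EuclideanSpace.single i 1)) =ᶠ[𝓝 x]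
      fun y => c * fderiv ℝ s y (EuclideanSpace.single i 1) := by
    filter_upwards [eventually_differentiableAt hs] with y h1
    rw [fderiv_const_mul h1]; rfl
  rw [h.fderiv_eq, fderiv_const_mul (differentiableAt_fderiv_apply hs _)]; rfl

lemma norm_gradient_sq (s : EuclideanSpace ℝ (Fin n) → ℝ) (x : EuclideanSpace ℝ (Fin n)) :
    ‖gradient s x‖ ^ 2 = ∑ i, fderiv ℝ s x (EuclideanSpace.single i 1) ^ 2 := by
  rw [EuclideanSpace.real_norm_sq_eq]
  refine Finset.sum_congr rfl fun i _ => ?_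
  rw [← toDual_gradient, InnerProductSpace.toDual_apply_apply, EuclideanSpace.inner_single_right]
  simp

lemma fderiv_apply_eq_inner_gradient (s : EuclideanSpace ℝ (Fin n) → ℝ)
    (x y : EuclideanSpace ℝ (Fin n)) : fderiv ℝ s x y = inner ℝ (gradient s x) y := by
  rw [← toDual_gradient, InnerProductSpace.toDual_apply_apply]

/-- Chain rule for the Laplacian of `g ∘ s`. -/
lemma elaplacian_comp {g g' : ℝ → ℝ} {g'' : ℝ} (hs : ContDiffAt ℝ 2 s x)
    (hg : ∀ᶠ r in 𝓝 (s x), HasDerivAt g (g' r) r) (hg' : HasDerivAt g' g'' (s x)) :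
    elaplacian (fun y => g (s y)) x = g' (s x) * elaplacian s x + g'' * ‖gradient s x‖ ^ 2 := by
  rw [norm_gradient_sq]
  unfold elaplacian
  rw [Finset.mul_sum, Finset.mul_sum, ← Finset.sum_add_distrib]
  refine Finset.sum_congr rfl fun i _ => ?_
  have h : (fun y => fderiv ℝ (fun y => g (s y)) y (EuclideanSpace.single i 1)) =ᶠ[𝓝 x]
      fun y => g' (s y) * fderiv ℝ s y (EuclideanSpace.single i 1) := by
    filter_upwards [eventually_differentiableAt hs, hs.continuousAt.eventually hg] with y h1 h2
    have := (h2.comp_hasFDerivAt y h1.hasFDerivAt).fderiv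
    simp only [Function.comp_def] at this
    rw [this]; simp
  rw [h.fderiv_eq]
  have h3 := (hg'.comp_hasFDerivAt x (hs.differentiableAt (by norm_num)).hasFDerivAt).mul
    (differentiableAt_fderiv_apply hs (EuclideanSpace.single i 1)).hasFDerivAt
  have h4 := h3.fderiv
  simp only [Function.comp_def, Pi.mul_def] at h4
  rw [h4]
  simp
  ring

lemma elaplacian_comp_affine (hv : ContDiff ℝ 2 v) (k : ℝ) (b : EuclideanSpace ℝ (Fin n)) :
    elaplacian (fun y => v (k • y + b)) x = k ^ 2 * elaplacian v (k • x + b) := by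
  unfold elaplacian
  rw [Finset.mul_sum]
  refine Finset.sum_congr rfl fun i _ => ?_
  have hT : ∀ y, HasFDerivAt (fun y : EuclideanSpace ℝ (Fin n) => k • y + b)
      (k • ContinuousLinearMap.id ℝ _) y := fun y =>
    ((hasFDerivAt_id y).const_smul k).add_const b
  have key : ∀ w : EuclideanSpace ℝ (Fin n) → ℝ, ∀ y e, DifferentiableAt ℝ w (k • y + b) →
      fderiv ℝ (fun y => w (k • y + b)) y e = k * fderiv ℝ w (k • y + b) e := by
    intro w y e hw
    have := (hw.hasFDerivAt.comp y (hT y)).fderiv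
    simp only [Function.comp_def] at this
    rw [this]; simp
  have h : (fun y => fderiv ℝ (fun y => v (k • y + b)) y (EuclideanSpace.single i 1)) =
      fun y => k * fderiv ℝ v (k • y + b) (EuclideanSpace.single i 1) := by
    funext y
    exact key v y _ (hv.differentiable (by norm_num) _)
  have hd : DifferentiableAt ℝ (fun y => fderiv ℝ v y (EuclideanSpace.single i 1)) (k • x + b) :=
    differentiableAt_fderiv_apply hv.contDiffAt _
  rw [h, fderiv_const_mul (DifferentiableAt.fun_comp' x hd (hT x).differentiableAt)]
  rw [smul_apply, key _ x _ hd, smul_eq_mul]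
  ring

lemma elaplacian_norm_sq_affine (c : ℝ) (e x₀ : EuclideanSpace ℝ (Fin n)) :
    elaplacian (fun y => ‖e + c • (y - x₀)‖ ^ 2) x = 2 * n * c ^ 2 := by
  unfold elaplacian
  have hX : ∀ y, HasFDerivAt (fun y : EuclideanSpace ℝ (Fin n) => e + c • (y - x₀))
      (c • ContinuousLinearMap.id ℝ _) y := fun y =>
    (((hasFDerivAt_id y).sub_const x₀).const_smul c).const_add e
  have h1 : ∀ i : Fin n, fderiv ℝ (fun y => fderiv ℝ (fun y => ‖e + c • (y - x₀)‖ ^ 2) y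
      (EuclideanSpace.single i 1)) x (EuclideanSpace.single i 1) = 2 * c ^ 2 := by
    intro i
    have h2 : (fun y => fderiv ℝ (fun y => ‖e + c • (y - x₀)‖ ^ 2) y
        (EuclideanSpace.single i 1)) = fun y => 2 * c * inner ℝ (e + c • (y - x₀))
          (EuclideanSpace.single i 1) := by
      funext y
      rw [(hX y).norm_sq.fderiv]
      simp [inner_add_left, inner_sub_left, inner_smul_left]
      ring
    rw [h2]
    have h3 := (((hX x).inner ℝ (hasFDerivAt_const (EuclideanSpace.single i (1:ℝ)) x)).const_mul
      (2 * c)).fderiv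
    rw [h3]
    simp [inner_smul_left, fderivInnerCLM_apply]
    ring
  rw [Finset.sum_congr rfl fun i _ => h1 i]
  simp
  ring

lemma IsLocalMax.deriv_deriv_nonpos {g : ℝ → ℝ} {r : ℝ} (h : IsLocalMax g r)
    (hc : ContinuousAt g r) : deriv (deriv g) r ≤ 0 := by
  by_contra! hpos
  have hmin := isLocalMin_of_deriv_deriv_pos hpos h.deriv_eq_zero hc
  have hconst : g =ᶠ[𝓝 r] fun _ => g r := by
    filter_upwards [h, hmin] with y h1 h2 using le_antisymm h1 h2
  have : deriv (deriv g) r = 0 := by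
    rw [hconst.deriv.deriv_eq]; simp
  linarith

lemma IsLocalMax.elaplacian_nonpos (h : IsLocalMax s x) (hs : ContDiffAt ℝ 2 s x) :
    elaplacian s x ≤ 0 := by
  refine Finset.sum_nonpos fun i _ => ?_
  set e : EuclideanSpace ℝ (Fin n) := EuclideanSpace.single i 1
  have hline : ∀ r : ℝ, HasDerivAt (fun r : ℝ => x + r • e) e r := fun r => by
    simpa using ((hasDerivAt_id r).smul_const e).const_add x
  have hcont : Tendsto (fun r : ℝ => x + r • e) (𝓝 0) (𝓝 x) := by
    simpa [ContinuousAt] using (hline 0).continuousAt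
  have hx : x + (0 : ℝ) • e = x := by simp
  have h1 : deriv (fun r : ℝ => s (x + r • e)) =ᶠ[𝓝 0] fun r => fderiv ℝ s (x + r • e) e := by
    filter_upwards [hcont.eventually (eventually_differentiableAt hs)] with r hr
    exact (hr.hasFDerivAt.comp_hasDerivAt r (hline r)).deriv
  have h2 : deriv (deriv (fun r : ℝ => s (x + r • e))) 0
      = fderiv ℝ (fun y => fderiv ℝ s y e) x e := by
    rw [h1.deriv_eq]
    have hd : HasFDerivAt (fun y => fderiv ℝ s y e) (fderiv ℝ (fun y => fderiv ℝ s y e) x)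
        (x + (0 : ℝ) • e) := by
      rw [hx]; exact (differentiableAt_fderiv_apply hs e).hasFDerivAt
    exact (hd.comp_hasDerivAt 0 (hline 0)).deriv
  rw [← h2]
  apply IsLocalMax.deriv_deriv_nonpos
  · have := hcont.eventually h
    filter_upwards [this] with r hr
    simpa using hr
  · have : ContinuousAt s (x + (0 : ℝ) • e) := by rw [hx]; exact hs.continuousAt
    exact ContinuousAt.comp (f := fun r : ℝ => x + r • e) this (hline 0).continuousAt

lemma ContDiffAt.continuousAt_elaplacian (hs : ContDiffAt ℝ 2 s x) :
    ContinuousAt (elaplacian s) x := by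
  unfold elaplacian
  refine tendsto_finsetSum _ fun i _ => ?_
  have h1 : ContDiffAt ℝ 1 (fun y => fderiv ℝ s y (EuclideanSpace.single i 1)) x :=
    (hs.fderiv_right (m := 1) (by norm_num)).clm_apply contDiffAt_const
  exact ((h1.fderiv_right (m := 0) (by norm_num)).continuousAt).clm_apply continuousAt_const

/-- If `Δv = f` with `f` of class `C¹`, then `⟨X, ∇v⟩`, for the conformal field
`X x = e + c (x - x₀)`, satisfies `Δ⟨X, ∇v⟩ = 2 c f + ⟨X, ∇f⟩` at `x₀` in the viscosity sense. -/
lemma fderiv_add_le_elaplacian_of_isLocalMax {f ψ : EuclideanSpace ℝ (Fin n) → ℝ}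
    {x₀ : EuclideanSpace ℝ (Fin n)} (hv : ContDiff ℝ 2 v) (hf : ContDiff ℝ 1 f)
    (hvf : ∀ x, elaplacian v x = f x) (e : EuclideanSpace ℝ (Fin n)) (c : ℝ)
    (hψ : ContDiffAt ℝ 2 ψ x₀)
    (hmax : IsLocalMax (fun x => fderiv ℝ v x (e + c • (x - x₀)) - ψ x) x₀) :
    2 * c * f x₀ + fderiv ℝ f x₀ e ≤ elaplacian ψ x₀ := by
  by_contra! hlt
  set X : EuclideanSpace ℝ (Fin n) → EuclideanSpace ℝ (Fin n) := fun x => e + c • (x - x₀)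
    with hX
  have hXc : Continuous X := by fun_prop
  have hX₀ : X x₀ = e := by simp [hX]
  set k : ℝ → EuclideanSpace ℝ (Fin n) → ℝ := fun s x => fderiv ℝ v (x + s • X x) (X x) with hk
  set D : ℝ → EuclideanSpace ℝ (Fin n) → ℝ := fun s x => 2 * c * (1 + s * c) * f (x + s • X x) +
    (1 + s * c) ^ 2 * fderiv ℝ f (x + s • X x) (X x) with hD
  have hv' : Continuous (fderiv ℝ v) := hv.continuous_fderiv (by norm_num)
  have hf' : Continuous (fderiv ℝ f) := hf.continuous_fderiv (by norm_num)
  have hfc : Continuous f := hf.continuous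
  have hkc : Continuous fun z : ℝ × EuclideanSpace ℝ (Fin n) => k z.1 z.2 := by
    simp only [hk]; fun_prop
  have hDc : Continuous fun z : ℝ × EuclideanSpace ℝ (Fin n) => D z.1 z.2 := by
    simp only [hD]; fun_prop
  have hD₀ : D 0 x₀ = 2 * c * f x₀ + fderiv ℝ f x₀ e := by simp [hD, hX₀]
  obtain ⟨ε, hε, hεD⟩ : ∃ ε > 0, elaplacian ψ x₀ + 2 * n * ε < D 0 x₀ := by
    refine ⟨(D 0 x₀ - elaplacian ψ x₀) / (2 * n + 1), div_pos (by linarith) (by positivity), ?_⟩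
    have h : 0 < D 0 x₀ - elaplacian ψ x₀ := by linarith
    have h2 : 2 * (n : ℝ) * ((D 0 x₀ - elaplacian ψ x₀) / (2 * n + 1))
        = (D 0 x₀ - elaplacian ψ x₀) - (D 0 x₀ - elaplacian ψ x₀) / (2 * n + 1) := by
      field_simp; ring
    have : 0 < (D 0 x₀ - elaplacian ψ x₀) / (2 * n + 1) := by positivity
    linarith
  have hev1 : ∀ᶠ z : ℝ × EuclideanSpace ℝ (Fin n) in 𝓝 (0, x₀),
      elaplacian ψ z.2 + 2 * n * ε < D z.1 z.2 := by
    have h1 : ContinuousAt (fun z : ℝ × EuclideanSpace ℝ (Fin n) => elaplacian ψ z.2 + 2 * n * ε)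
        (0, x₀) := by
      have : ContinuousAt (elaplacian ψ) ((0 : ℝ), x₀).2 := hψ.continuousAt_elaplacian
      exact (this.comp continuousAt_snd).add continuousAt_const
    exact h1.eventually_lt hDc.continuousAt hεD
  have hev2 : ∀ᶠ z : ℝ × EuclideanSpace ℝ (Fin n) in 𝓝 (0, x₀),
      ContDiffAt ℝ 2 ψ z.2 ∧ k 0 z.2 - ψ z.2 ≤ k 0 x₀ - ψ x₀ := by
    have h1 : ∀ᶠ x in 𝓝 x₀, ContDiffAt ℝ 2 ψ x ∧ k 0 x - ψ x ≤ k 0 x₀ - ψ x₀ := by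
      filter_upwards [hψ.eventually (by simp), hmax] with x h1 h2
      exact ⟨h1, by simpa only [hk, zero_smul, add_zero] using h2⟩
    exact (continuous_snd.tendsto ((0 : ℝ), x₀)).eventually h1
  obtain ⟨r, hr, hball⟩ := Metric.eventually_nhds_iff.1 (hev1.and hev2)
  set ρ := r / 2
  have hρ : 0 < ρ := half_pos hr
  have hK : IsCompact (Metric.closedBall x₀ ρ) := isCompact_closedBall x₀ ρ
  have hunif : ∀ᶠ s in 𝓝 (0 : ℝ), ∀ x ∈ Metric.closedBall x₀ ρ,
      |k s x - k 0 x| < ε * ρ ^ 2 / 2 := by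
    apply hK.eventually_forall_of_forall_eventually
    intro y _
    have h1 : Continuous fun z : ℝ × EuclideanSpace ℝ (Fin n) => |k z.1 z.2 - k 0 z.2| := by
      have : Continuous fun z : ℝ × EuclideanSpace ℝ (Fin n) => k 0 z.2 :=
        hkc.comp (f := fun z : ℝ × EuclideanSpace ℝ (Fin n) => ((0 : ℝ), z.2)) (by fun_prop)
      exact (hkc.sub this).abs
    exact h1.continuousAt.eventually_lt continuousAt_const (by simpa using by positivity)
  obtain ⟨δ, hδ, hunif⟩ := Metric.eventually_nhds_iff.1 hunif
  obtain ⟨t, ht, htδ, htr⟩ : ∃ t : ℝ, 0 < t ∧ t < δ ∧ t < r :=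
    ⟨min δ r / 2, by positivity, by linarith [min_le_left δ r, lt_min hδ hr],
      by linarith [min_le_right δ r, lt_min hδ hr]⟩
  have hline : ∀ x s, HasDerivAt (fun s : ℝ => x + s • X x) (X x) s := fun x s => by
    simpa using ((hasDerivAt_id s).smul_const (X x)).const_add x
  have hslope : ∀ x, ∃ s ∈ Set.Ioo 0 t, k s x = (v (x + t • X x) - v x) / t := by
    intro x
    have hd : ∀ s, HasDerivAt (fun s : ℝ => v (x + s • X x)) (k s x) s := fun s =>
      ((hv.differentiable (by norm_num) _).hasFDerivAt).comp_hasDerivAt s (hline x s)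
    obtain ⟨s, hs, h⟩ := exists_hasDerivAt_eq_slope _ _ ht
      (fun s _ => (hd s).continuousAt.continuousWithinAt) fun s _ => hd s
    exact ⟨s, hs, by simpa using h⟩
  have hslopeD : ∀ x, ∃ s ∈ Set.Ioo 0 t,
      D s x = ((1 + t * c) ^ 2 * f (x + t • X x) - f x) / t := by
    intro x
    have hd : ∀ s, HasDerivAt (fun s : ℝ => (1 + s * c) ^ 2 * f (x + s • X x)) (D s x) s := by
      intro s
      have h1 := ((hf.differentiable (by norm_num) _).hasFDerivAt).comp_hasDerivAt s (hline x s)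
      have h2 : HasDerivAt (fun s : ℝ => (1 + s * c) ^ 2) (2 * c * (1 + s * c)) s := by
        have := (((hasDerivAt_id s).mul_const c).const_add 1).pow 2
        refine this.congr_deriv ?_
        simp; ring
      exact h2.mul h1
    obtain ⟨s, hs, h⟩ := exists_hasDerivAt_eq_slope _ _ ht
      (fun s _ => (hd s).continuousAt.continuousWithinAt) fun s _ => hd s
    exact ⟨s, hs, by simpa using h⟩
  set b : EuclideanSpace ℝ (Fin n) := t • (e - c • x₀) with hb
  have haff : ∀ x, x + t • X x = (1 + t * c) • x + b := fun x => by
    simp only [hX, hb]; module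
  set G : EuclideanSpace ℝ (Fin n) → ℝ := fun x =>
    (t⁻¹ * v ((1 + t * c) • x + b) + -t⁻¹ * v x) +
      (-1 * ψ x + -ε * ‖(0 : EuclideanSpace ℝ (Fin n)) + (1 : ℝ) • (x - x₀)‖ ^ 2) with hG
  have hGeq : ∀ x, G x = (v (x + t • X x) - v x) / t - ψ x - ε * ‖x - x₀‖ ^ 2 := fun x => by
    simp only [hG, haff, zero_add, one_smul]; field_simp; ring
  have hGk : ∀ x ∈ Metric.closedBall x₀ ρ, |G x - (k 0 x - ψ x - ε * ‖x - x₀‖ ^ 2)|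
      < ε * ρ ^ 2 / 2 := by
    intro x hx
    obtain ⟨s, hs, h⟩ := hslope x
    rw [hGeq, ← h]
    have := hunif (y := s) (by rw [Real.dist_0_eq_abs, abs_of_pos hs.1]; linarith [hs.2]) x hx
    convert this using 2; ring
  have hnear : ∀ x ∈ Metric.closedBall x₀ ρ, ∀ s ∈ Set.Ico 0 t, dist (s, x) ((0 : ℝ), x₀) < r := by
    intro x hx s hs
    rw [Prod.dist_eq]
    refine max_lt ?_ (lt_of_le_of_lt hx (half_lt_self hr))
    simp only [Real.dist_0_eq_abs]
    rw [abs_of_nonneg hs.1]; linarith [hs.2]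
  have hreg : ∀ x ∈ Metric.closedBall x₀ ρ, ContDiffAt ℝ 2 ψ x := fun x hx =>
    (hball (hnear x hx 0 ⟨le_rfl, ht⟩)).2.1
  have hC1 : ContDiff ℝ 2 fun x => v ((1 + t * c) • x + b) := by fun_prop
  have hC3 : ContDiff ℝ 2 fun x : EuclideanSpace ℝ (Fin n) =>
      ‖(0 : EuclideanSpace ℝ (Fin n)) + (1 : ℝ) • (x - x₀)‖ ^ 2 :=
    ContDiff.norm_sq ℝ (by fun_prop)
  have hGreg1 : ContDiff ℝ 2 fun x => t⁻¹ * v ((1 + t * c) • x + b) + -t⁻¹ * v x := by fun_prop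
  have hGreg2 : ∀ x ∈ Metric.closedBall x₀ ρ, ContDiffAt ℝ 2 (fun x => -1 * ψ x +
      -ε * ‖(0 : EuclideanSpace ℝ (Fin n)) + (1 : ℝ) • (x - x₀)‖ ^ 2) x := fun x hx =>
    (contDiffAt_const.mul (hreg x hx)).add (contDiffAt_const.mul hC3.contDiffAt)
  have hGreg : ∀ x ∈ Metric.closedBall x₀ ρ, ContDiffAt ℝ 2 G x := fun x hx =>
    hGreg1.contDiffAt.add (hGreg2 x hx)
  have hx₀K : x₀ ∈ Metric.closedBall x₀ ρ := Metric.mem_closedBall_self hρ.le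
  obtain ⟨x₁, hx₁, hloc⟩ := hK.exists_isLocalMax_mem_open (f := G) Metric.ball_subset_closedBall
    (fun x hx => (hGreg x hx).continuousAt.continuousWithinAt) hx₀K (fun z hz => by
      have h1 := abs_lt.1 (hGk z hz.1)
      have h2 := abs_lt.1 (hGk x₀ hx₀K)
      have h3 := (hball (hnear z hz.1 0 ⟨le_rfl, ht⟩)).2.2
      have h4 : ‖z - x₀‖ = ρ := by
        rw [← dist_eq_norm]
        exact le_antisymm hz.1 (not_lt.1 fun h => hz.2 h)
      rw [h4] at h1
      simp only [sub_self, norm_zero] at h2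
      simp only at h3
      linarith [h1.2, h2.1]) Metric.isOpen_ball
  have hx₁K := Metric.ball_subset_closedBall hx₁
  have hle := hloc.elaplacian_nonpos (hGreg x₁ hx₁K)
  rw [hG, elaplacian_add hGreg1.contDiffAt (hGreg2 x₁ hx₁K),
    elaplacian_add (contDiffAt_const.mul hC1.contDiffAt) (contDiffAt_const.mul hv.contDiffAt),
    elaplacian_add (contDiffAt_const.mul (hreg x₁ hx₁K)) (contDiffAt_const.mul hC3.contDiffAt),
    elaplacian_const_mul _ hC1.contDiffAt, elaplacian_const_mul _ hv.contDiffAt,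
    elaplacian_const_mul _ (hreg x₁ hx₁K), elaplacian_const_mul _ hC3.contDiffAt,
    elaplacian_comp_affine hv, elaplacian_norm_sq_affine, hvf, hvf, ← haff] at hle
  obtain ⟨s, hs, hsD⟩ := hslopeD x₁
  have hfin := (hball (hnear x₁ hx₁K s ⟨hs.1.le, hs.2⟩)).1
  simp only at hfin
  rw [hsD, sub_div, div_eq_inv_mul, div_eq_inv_mul] at hfin
  linarith

/-- Bochner's inequality in the viscosity sense: if `Δv = f` with `f` of class `C¹`, then
`Δ|∇v|² ≥ 2⟨∇f, ∇v⟩ + 2 f² / n`. -/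
lemma bochner_le_elaplacian_of_isLocalMax {f φ : EuclideanSpace ℝ (Fin n) → ℝ}
    {x₀ : EuclideanSpace ℝ (Fin n)} (hn : 0 < n) (hv : ContDiff ℝ 2 v) (hf : ContDiff ℝ 1 f)
    (hvf : ∀ x, elaplacian v x = f x) (hφ : ContDiffAt ℝ 2 φ x₀)
    (hmax : IsLocalMax (fun x => ‖gradient v x‖ ^ 2 - φ x) x₀) :
    2 * fderiv ℝ f x₀ (gradient v x₀) + 2 / n * f x₀ ^ 2 ≤ elaplacian φ x₀ := by
  set e := gradient v x₀ with he
  set c := f x₀ / n with hc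
  have hC : ContDiff ℝ 2 fun x : EuclideanSpace ℝ (Fin n) => ‖e + c • (x - x₀)‖ ^ 2 :=
    ContDiff.norm_sq ℝ (by fun_prop)
  have hC' : ContDiffAt ℝ 2 (fun x => φ x + ‖e + c • (x - x₀)‖ ^ 2) x₀ := hφ.add hC.contDiffAt
  have key := fderiv_add_le_elaplacian_of_isLocalMax
    (ψ := fun x => 1 / 2 * (φ x + ‖e + c • (x - x₀)‖ ^ 2)) hv hf hvf e c
    (contDiffAt_const.mul hC') (by
      filter_upwards [hmax] with x hx
      simp only [sub_self, smul_zero, add_zero, fderiv_apply_eq_inner_gradient] at hx ⊢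
      rw [← he, real_inner_self_eq_norm_sq]
      have h := norm_sub_sq_real (gradient v x) (e + c • (x - x₀))
      nlinarith [sq_nonneg ‖gradient v x - (e + c • (x - x₀))‖])
  rw [elaplacian_const_mul _ hC', elaplacian_add hφ hC.contDiffAt,
    elaplacian_norm_sq_affine] at key
  have hn' : (n : ℝ) ≠ 0 := by positivity
  have h1 : f x₀ = n * c := by rw [hc]; field_simp
  have h2 : 2 / n * f x₀ ^ 2 = 4 * c * f x₀ - 2 * n * c ^ 2 := by
    rw [h1]; field_simp; ring
  linarith

lemma sq_le_of_bochner {N q b F y A k D d f' l : ℝ} (hN : 1 ≤ N) (hq : 2 < q) (hb : 0 ≤ b)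
    (hF : 0 ≤ F) (hbF : N * q * b ≤ F) (hy : 0 < y) (hA : 0 ≤ A) (hAy : A ≤ y ^ 2) (hk : 0 ≤ k)
    (hd : d ≤ 4 * k * y) (hD : D = (y ^ 2 - A) * d - b * A * y ^ 2)
    (hf' : f' = -((1 + q / 2 * F) * D + (q - 2) / 2 * b * F * y ^ 2 * y ^ 2))
    (hl : l ≤ (y ^ 2 - A) * ((4 * N + 24) * k ^ 2) + A * (b ^ 2 * y ^ 2 + b * (y ^ 2 * (1 + F))))
    (h : 2 * f' + 2 / N * (y ^ 2 * (1 + F)) ^ 2 ≤ l) :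
    y ^ 2 ≤ (4 * N * (4 * N + 24) + 64 * N ^ 2 * q ^ 2) * k ^ 2 := by
  have hN0 : 0 < N := by linarith
  have hL : 0 ≤ y ^ 2 - A := by linarith
  have hbq : q * b ≤ F / N := by rw [le_div_iff₀ hN0]; linarith
  have hbF2 : b ^ 2 ≤ F ^ 2 / (2 * N) := by
    have h1 : (q * b) ^ 2 ≤ (F / N) ^ 2 := pow_le_pow_left₀ (by positivity) hbq 2
    have h2 : (F / N) ^ 2 ≤ F ^ 2 / N := by
      rw [div_pow]
      exact div_le_div_of_nonneg_left (by positivity) hN0 (by nlinarith)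
    have h3 : 4 * b ^ 2 ≤ (q * b) ^ 2 := by
      rw [mul_pow]; exact mul_le_mul_of_nonneg_right (by nlinarith) (sq_nonneg b)
    have h4 : F ^ 2 / (2 * N) = F ^ 2 / N / 2 := by field_simp
    have h5 : 0 ≤ b ^ 2 := sq_nonneg b
    linarith
  have hqF : (q - 2) * b * F ≤ F ^ 2 / N := by
    have : (q * b) * F ≤ F / N * F := mul_le_mul_of_nonneg_right hbq hF
    have h2 : F / N * F = F ^ 2 / N := by ring
    linarith [mul_nonneg hb hF]
  have hcoef : (1 + F) ^ 2 / (2 * N) ≤ 2 / N * (1 + F) ^ 2 - (q - 2) * b * F - b ^ 2 := by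
    have h1 : (1 + F) ^ 2 / (2 * N) = (1 + F) ^ 2 / N / 2 := by field_simp
    have h2 : 2 / N * (1 + F) ^ 2 = 2 * ((1 + F) ^ 2 / N) := by ring
    have h3 : F ^ 2 / N ≤ (1 + F) ^ 2 / N := by gcongr; linarith
    have h4 : F ^ 2 / (2 * N) = F ^ 2 / N / 2 := by field_simp
    linarith
  have hlow : y ^ 2 * y ^ 2 * ((1 + F) ^ 2 / (2 * N)) ≤
      y ^ 2 * ((4 * N + 24) * k ^ 2 + 4 * q * (1 + F) * (k * y)) := by
    have h1 := mul_le_mul_of_nonneg_left hcoef (by positivity : 0 ≤ y ^ 2 * y ^ 2)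
    have h2 : 0 ≤ b * A * y ^ 2 * (1 + (q - 1) * F) := by
      have : 0 ≤ (q - 1) * F := mul_nonneg (by linarith) hF
      positivity
    have h3 : A * (b ^ 2 * y ^ 2) ≤ y ^ 2 * (b ^ 2 * y ^ 2) :=
      mul_le_mul_of_nonneg_right hAy (by positivity)
    have h4 : (y ^ 2 - A) * ((4 * N + 24) * k ^ 2) ≤ y ^ 2 * ((4 * N + 24) * k ^ 2) :=
      mul_le_mul_of_nonneg_right (by linarith) (by positivity)
    have h5 : (2 + q * F) * ((y ^ 2 - A) * d) ≤ y ^ 2 * (4 * q * (1 + F) * (k * y)) := by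
      have h6 : (y ^ 2 - A) * d ≤ y ^ 2 * (4 * k * y) :=
        (mul_le_mul_of_nonneg_left hd hL).trans
          (mul_le_mul_of_nonneg_right (by linarith) (by positivity))
      calc (2 + q * F) * ((y ^ 2 - A) * d) ≤ (2 + q * F) * (y ^ 2 * (4 * k * y)) :=
            mul_le_mul_of_nonneg_left h6 (by positivity)
        _ ≤ (q * (1 + F)) * (y ^ 2 * (4 * k * y)) :=
            mul_le_mul_of_nonneg_right (by linarith) (by positivity)
        _ = _ := by ring
    subst hf' hD
    have h6 : 2 / N * (y ^ 2 * (1 + F)) ^ 2 = y ^ 2 * y ^ 2 * (2 / N * (1 + F) ^ 2) := by ring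
    rw [h6] at h
    linarith
  have hT : (y * (1 + F)) ^ 2 ≤
      2 * N * ((4 * N + 24) * k ^ 2 + 4 * q * (1 + F) * (k * y)) := by
    have h1 : y ^ 2 * ((1 + F) ^ 2 / (2 * N)) ≤
        (4 * N + 24) * k ^ 2 + 4 * q * (1 + F) * (k * y) := by
      rw [mul_assoc] at hlow
      exact le_of_mul_le_mul_left hlow (by positivity)
    have h2 : y ^ 2 * ((1 + F) ^ 2 / (2 * N)) = (y * (1 + F)) ^ 2 / (2 * N) := by ring
    rw [h2, div_le_iff₀ (by positivity)] at h1
    linarith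
  have hyT : y ^ 2 ≤ (y * (1 + F)) ^ 2 := by
    apply pow_le_pow_left₀ hy.le
    nlinarith
  linarith [sq_nonneg (y * (1 + F) - 8 * N * q * k)]

lemma ContDiff.norm_gradient_sq (hv : ContDiff ℝ 2 v) :
    ContDiff ℝ 1 fun x => ‖gradient v x‖ ^ 2 := by
  have : ContDiff ℝ 1 (gradient v) :=
    (InnerProductSpace.toDual ℝ (EuclideanSpace ℝ (Fin n))).symm.contDiff.comp
      (hv.fderiv_right (m := 1) (by norm_num))
  exact this.norm_sq ℝ

lemma hasGradientAt_norm_sub_sq (x₀ x : EuclideanSpace ℝ (Fin n)) :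
    HasGradientAt (fun y => ‖y - x₀‖ ^ 2) ((2 : ℝ) • (x - x₀)) x := by
  rw [hasGradientAt_iff_hasFDerivAt]
  refine ((hasFDerivAt_id x).sub_const x₀).norm_sq.congr_fderiv ?_
  ext y
  simp

/-- Local gradient estimate for `v = log u`, where `u` solves the equation. -/
lemma norm_gradient_sq_le_add_div {q b M : ℝ} (hn : 0 < n) (hq : 2 < q) (hb : 0 ≤ b)
    (hM : 0 < M) (hbM : n * q * b ≤ M) (hv : ContDiff ℝ 2 v)
    (hvf : ∀ x, elaplacian v x = -(‖gradient v x‖ ^ 2 +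
      (‖gradient v x‖ ^ 2) ^ (q / 2) * Real.exp ((q - 2) / 2 * b * v x)))
    (x₀ : EuclideanSpace ℝ (Fin n)) {R : ℝ} (hR : 0 < R) :
    ‖gradient v x₀‖ ^ 2 ≤ M ^ (2 / (q - 2)) * Real.exp (-b * v x₀) +
      (4 * n * (4 * n + 24) + 64 * n ^ 2 * q ^ 2) / R ^ 2 := by
  set C : ℝ := 4 * n * (4 * n + 24) + 64 * n ^ 2 * q ^ 2 with hC
  set m := M ^ (2 / (q - 2)) with hm
  have hm0 : 0 < m := Real.rpow_pos_of_pos hM _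
  set h : EuclideanSpace ℝ (Fin n) → ℝ := fun x => ‖gradient v x‖ ^ 2 with hh
  have hh1 : ContDiff ℝ 1 h := hv.norm_gradient_sq
  set f : EuclideanSpace ℝ (Fin n) → ℝ :=
    fun x => -(h x + h x ^ (q / 2) * Real.exp ((q - 2) / 2 * b * v x)) with hf
  have hv1 : ContDiff ℝ 1 v := hv.of_le (by norm_num)
  have hf1 : ContDiff ℝ 1 f := by
    have h1 : ContDiff ℝ 1 fun x => h x ^ (q / 2) :=
      hh1.rpow_const_of_le (m := 1) (by simp; linarith)
    fun_prop
  set P : EuclideanSpace ℝ (Fin n) → ℝ := fun x => ‖x - x₀‖ ^ 2 with hP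
  have hP2 : ContDiff ℝ 2 P := ContDiff.norm_sq ℝ (by fun_prop)
  set S : EuclideanSpace ℝ (Fin n) → ℝ := fun x => 1 - P x / R ^ 2 with hS
  set B : EuclideanSpace ℝ (Fin n) → ℝ := fun x => Real.exp (-b * v x) with hB
  have hB2 : ContDiff ℝ 2 B := by fun_prop
  set Φ : EuclideanSpace ℝ (Fin n) → ℝ := fun x => S x ^ 2 * (h x - m * B x) with hΦ
  have hPc : Continuous P := hP2.continuous
  have hhc : Continuous h := hh1.continuous
  have hBc : Continuous B := hB2.continuous
  have hSc : Continuous S := by fun_prop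
  have hΦc : Continuous Φ := by fun_prop
  obtain ⟨x₁, hx₁, hmax⟩ := (isCompact_closedBall x₀ R).exists_isMaxOn
    ⟨x₀, Metric.mem_closedBall_self hR.le⟩ hΦc.continuousOn
  by_contra! hcon
  have hΦ₀ : C / R ^ 2 < Φ x₀ := by
    have : S x₀ = 1 := by simp [hS, hP]
    simp only [hΦ, this]; linarith
  have hΦ₁ : C / R ^ 2 < Φ x₁ := hΦ₀.trans_le (hmax (Metric.mem_closedBall_self hR.le))
  have hC0 : 0 ≤ C := by positivity
  have hΦ₁0 : 0 < Φ x₁ := lt_of_le_of_lt (by positivity) hΦ₁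
  have hP0 : ∀ x, 0 ≤ P x := fun x => sq_nonneg _
  have hPR : P x₁ ≤ R ^ 2 := by
    rw [Metric.mem_closedBall, dist_eq_norm] at hx₁
    exact pow_le_pow_left₀ (norm_nonneg _) hx₁ 2
  have hS0 : 0 < S x₁ := by
    have h1 : 0 ≤ S x₁ := by
      simp only [hS, sub_nonneg]; exact div_le_one_of_le₀ hPR (by positivity)
    refine lt_of_le_of_ne h1 fun h2 => ?_
    simp only [hΦ, ← h2] at hΦ₁0
    simp at hΦ₁0
  have hS1 : S x₁ ≤ 1 := by
    have : 0 ≤ P x₁ / R ^ 2 := div_nonneg (hP0 _) (by positivity)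
    simp only [hS]; linarith
  have hgap : 0 < h x₁ - m * B x₁ := (mul_pos_iff_of_pos_left (by positivity)).1 hΦ₁0
  have hBpos : ∀ x, 0 < B x := fun x => Real.exp_pos _
  have hmax' : ∀ᶠ x in 𝓝 x₁, Φ x ≤ Φ x₁ := by
    have hball : Metric.ball x₀ R ∈ 𝓝 x₁ := by
      refine Metric.isOpen_ball.mem_nhds ?_
      rw [Metric.mem_ball, dist_eq_norm]
      refine lt_of_pow_lt_pow_left₀ 2 hR.le ?_
      have : P x₁ / R ^ 2 < 1 := by simp only [hS] at hS0; linarith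
      rwa [div_lt_one (by positivity)] at this
    filter_upwards [hball] with x hx using hmax (Metric.ball_subset_closedBall hx)
  set l := Φ x₁ with hl
  set g : ℝ → ℝ := fun r => ((1 - r / R ^ 2) ^ 2)⁻¹ with hg
  set g' : ℝ → ℝ := fun r => 2 / R ^ 2 * ((1 - r / R ^ 2) ^ 3)⁻¹ with hg'
  have hder : ∀ r, HasDerivAt (fun r : ℝ => 1 - r / R ^ 2) (-(1 / R ^ 2)) r := fun r =>
    ((hasDerivAt_id r).div_const _).const_sub 1
  have hgder : ∀ r, 1 - r / R ^ 2 ≠ 0 → HasDerivAt g (g' r) r := fun r hr => by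
    refine (((hder r).pow 2).inv (pow_ne_zero 2 hr)).congr_deriv ?_
    simp only [hg', Pi.pow_apply]
    generalize 1 - r / R ^ 2 = z at hr ⊢
    field_simp
    norm_num
    ring
  have hg'der : ∀ r, 1 - r / R ^ 2 ≠ 0 →
      HasDerivAt g' (6 / R ^ 4 * ((1 - r / R ^ 2) ^ 4)⁻¹) r := fun r hr => by
    refine ((((hder r).pow 3).inv (pow_ne_zero 3 hr)).const_mul (2 / R ^ 2)).congr_deriv ?_
    simp only [Pi.pow_apply]
    generalize 1 - r / R ^ 2 = z at hr ⊢
    field_simp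
    norm_num
    ring
  have hSne : 1 - P x₁ / R ^ 2 ≠ 0 := hS0.ne'
  have hSev : ∀ᶠ r in 𝓝 (P x₁), HasDerivAt g (g' r) r := by
    have : Continuous fun r : ℝ => 1 - r / R ^ 2 := by fun_prop
    filter_upwards [this.continuousAt.eventually_ne hSne] with r hr using hgder r hr
  have hgP2 : ContDiffAt ℝ 2 (fun x => g (P x)) x₁ := by
    have h1 : ContDiffAt ℝ 2 (fun x => (1 - P x / R ^ 2) ^ 2) x₁ := by
      have := hP2.contDiffAt (x := x₁)
      fun_prop
    exact h1.inv (pow_ne_zero 2 hSne)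
  set φ : EuclideanSpace ℝ (Fin n) → ℝ := fun x => l * g (P x) + m * B x with hφ
  have hφ2 : ContDiffAt ℝ 2 φ x₁ :=
    (contDiffAt_const.mul hgP2).add (contDiffAt_const.mul hB2.contDiffAt)
  have hgS : ∀ x, g (P x) = (S x ^ 2)⁻¹ := fun x => rfl
  have hlg : l * g (P x₁) = h x₁ - m * B x₁ := by
    rw [hgS, hl]; simp only [hΦ]; field_simp
  have hloc : IsLocalMax (fun x => h x - φ x) x₁ := by
    filter_upwards [hmax', hSc.continuousAt.eventually_ne hS0.ne'] with x hx hSx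
    have h1 : h x - m * B x ≤ l * g (P x) := by
      rw [hgS, ← div_eq_mul_inv, le_div_iff₀ (by positivity)]
      simp only [hΦ] at hx ⊢; linarith
    simp only [hφ]; linarith
  have hboch := bochner_le_elaplacian_of_isLocalMax hn hv hf1 hvf hφ2 hloc
  set w := gradient v x₁ with hw
  set y := ‖w‖ with hy
  have hhy : h x₁ = y ^ 2 := rfl
  have hA0 : 0 ≤ m * B x₁ := mul_nonneg hm0.le (hBpos _).le
  have hy0 : 0 < y := by
    have : 0 < y ^ 2 := by rw [← hhy]; linarith
    exact (sq_pos_iff.1 this).lt_of_le' (norm_nonneg _)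
  have hhne : h x₁ ≠ 0 := by rw [hhy]; positivity
  have hvw : fderiv ℝ v x₁ w = y ^ 2 := by
    rw [fderiv_apply_eq_inner_gradient, real_inner_self_eq_norm_sq]
  set F := h x₁ ^ (q / 2 - 1) * Real.exp ((q - 2) / 2 * b * v x₁) with hF
  have hpow : h x₁ ^ (q / 2) = h x₁ * h x₁ ^ (q / 2 - 1) := by
    rw [Real.rpow_sub_one hhne]; field_simp
  have hFM : M ≤ F := by
    have h1 : (m * B x₁) ^ (q / 2 - 1) ≤ h x₁ ^ (q / 2 - 1) :=
      Real.rpow_le_rpow hA0 (by linarith) (by linarith)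
    have h2 : (m * B x₁) ^ (q / 2 - 1) = M * Real.exp (-((q - 2) / 2 * b * v x₁)) := by
      rw [Real.mul_rpow hm0.le (hBpos _).le, hm, ← Real.rpow_mul hM.le]
      simp only [hB]
      rw [← Real.exp_mul]
      have h3 : 2 / (q - 2) * (q / 2 - 1) = 1 := by
        have : q - 2 ≠ 0 := by linarith
        field_simp
      rw [h3, Real.rpow_one]
      congr 2; ring
    rw [h2, Real.exp_neg, ← div_eq_mul_inv, div_le_iff₀ (Real.exp_pos _)] at h1
    exact h1
  have hfx : f x₁ = -(y ^ 2 * (1 + F)) := by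
    simp only [hf, hpow, hF, ← hhy]; ring
  have hvd : HasFDerivAt v (fderiv ℝ v x₁) x₁ :=
    (hv1.differentiable (by norm_num) x₁).hasFDerivAt
  have hhd : HasFDerivAt h (fderiv ℝ h x₁) x₁ :=
    (hh1.differentiable (by norm_num) x₁).hasFDerivAt
  have hPd : HasFDerivAt P (fderiv ℝ P x₁) x₁ :=
    (hP2.differentiable (by norm_num) x₁).hasFDerivAt
  have hPgrad : gradient P x₁ = (2 : ℝ) • (x₁ - x₀) := (hasGradientAt_norm_sub_sq x₀ x₁).gradient
  have hBd : HasFDerivAt B (B x₁ • (-b) • fderiv ℝ v x₁) x₁ := (hvd.const_mul (-b)).exp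
  have hφd : HasFDerivAt φ (l • g' (P x₁) • fderiv ℝ P x₁ + m • B x₁ • (-b) • fderiv ℝ v x₁)
      x₁ :=
    (((hgder _ hSne).comp_hasFDerivAt x₁ hPd).const_mul l).add (hBd.const_mul m)
  have hDeq : fderiv ℝ h x₁ = l • g' (P x₁) • fderiv ℝ P x₁ + m • B x₁ • (-b) • fderiv ℝ v x₁ :=
    sub_eq_zero.1 (hloc.hasFDerivAt_eq_zero (hhd.sub hφd))
  have hfd : HasFDerivAt f _ x₁ :=
    (hhd.add ((hhd.rpow_const (p := q / 2) (Or.inl hhne)).mul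
      ((hvd.const_mul ((q - 2) / 2 * b)).exp))).neg
  set k := (R * S x₁)⁻¹ with hk
  have hk0 : 0 ≤ k := by positivity
  set d := 4 / (R ^ 2 * S x₁) * inner ℝ (x₁ - x₀) w with hd
  have hinner : inner ℝ (x₁ - x₀) w ≤ R * y :=
    (real_inner_le_norm _ _).trans (mul_le_mul_of_nonneg_right
      (by rwa [Metric.mem_closedBall, dist_eq_norm] at hx₁) (norm_nonneg _))
  have hd4 : d ≤ 4 * k * y := by
    calc d ≤ 4 / (R ^ 2 * S x₁) * (R * y) := mul_le_mul_of_nonneg_left hinner (by positivity)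
      _ = 4 * k * y := by rw [hk]; field_simp
  have hD : fderiv ℝ h x₁ w = (y ^ 2 - m * B x₁) * d - b * (m * B x₁) * y ^ 2 := by
    rw [hDeq, ← hhy, ← hlg]
    simp only [add_apply, smul_apply, smul_eq_mul, hvw, fderiv_apply_eq_inner_gradient P, hPgrad,
      inner_smul_left, hgS, hg', hd, ← hhy]
    rw [show 1 - P x₁ / R ^ 2 = S x₁ from rfl]
    simp only [RCLike.conj_to_real]
    field_simp
    ring
  have hf' : fderiv ℝ f x₁ w = -((1 + q / 2 * F) * fderiv ℝ h x₁ w +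
      (q - 2) / 2 * b * F * y ^ 2 * y ^ 2) := by
    rw [hfd.fderiv]
    simp only [neg_apply, add_apply, smul_apply, smul_eq_mul, hvw, hpow, hF, ← hhy]
    ring
  have hlapB : elaplacian B x₁ = B x₁ * (b ^ 2 * y ^ 2 + b * (y ^ 2 * (1 + F))) := by
    have h1 : ∀ r, HasDerivAt (fun r => Real.exp (-b * r)) (-b * Real.exp (-b * r)) r := fun r =>
      (((hasDerivAt_id r).const_mul (-b)).exp).congr_deriv (by simp; ring)
    have h2 := elaplacian_comp (x := x₁) hv.contDiffAt (Eventually.of_forall h1)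
      ((h1 (v x₁)).const_mul (-b))
    rw [hvf x₁, show -(‖gradient v x₁‖ ^ 2 + _) = f x₁ from rfl, hfx] at h2
    simp only [hB]
    rw [h2, ← hw, ← hy]
    ring
  have hlapg : l * elaplacian (fun x => g (P x)) x₁ ≤
      (y ^ 2 - m * B x₁) * ((4 * n + 24) * k ^ 2) := by
    have hlapP : elaplacian P x₁ = 2 * n := by
      simpa using elaplacian_norm_sq_affine (x := x₁) 1 0 x₀
    rw [elaplacian_comp hP2.contDiffAt hSev (hg'der _ hSne), hlapP, hPgrad, norm_smul,
      ← hhy, ← hlg, hgS, mul_assoc l]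
    refine mul_le_mul_of_nonneg_left ?_ hΦ₁0.le
    simp only [hg']
    rw [show 1 - P x₁ / R ^ 2 = S x₁ from rfl, mul_pow, show ‖x₁ - x₀‖ ^ 2 = P x₁ from rfl]
    have h1 : 2 / R ^ 2 * (S x₁ ^ 3)⁻¹ * (2 * n) +
        6 / R ^ 4 * (S x₁ ^ 4)⁻¹ * (‖(2 : ℝ)‖ ^ 2 * P x₁) =
        (S x₁ ^ 2)⁻¹ * ((4 * n * S x₁ + 24 * (P x₁ / R ^ 2)) * k ^ 2) := by
      rw [hk]; norm_num; field_simp; ring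
    rw [h1]
    have h2 : P x₁ / R ^ 2 ≤ 1 := div_le_one_of_le₀ hPR (by positivity)
    have h3 : 4 * n * S x₁ ≤ 4 * n * 1 := mul_le_mul_of_nonneg_left hS1 (by positivity)
    exact mul_le_mul_of_nonneg_left (mul_le_mul_of_nonneg_right (by linarith) (by positivity))
      (by positivity)
  have hlap : elaplacian φ x₁ ≤ (y ^ 2 - m * B x₁) * ((4 * n + 24) * k ^ 2) +
      m * B x₁ * (b ^ 2 * y ^ 2 + b * (y ^ 2 * (1 + F))) := by
    rw [hφ, elaplacian_add (contDiffAt_const.mul hgP2) (contDiffAt_const.mul hB2.contDiffAt),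
      elaplacian_const_mul _ hgP2, elaplacian_const_mul _ hB2.contDiffAt, hlapB, ← mul_assoc m]
    linarith
  rw [hfx, neg_sq] at hboch
  have hfin := sq_le_of_bochner (by exact_mod_cast hn) hq hb (hM.le.trans hFM) (hbM.trans hFM) hy0
    hA0 (by linarith) hk0 hd4 hD hf' hlap hboch
  have h1 : l ≤ S x₁ ^ 2 * y ^ 2 := by
    rw [hl]; simp only [hΦ]
    exact mul_le_mul_of_nonneg_left (by linarith) (by positivity)
  have h2 : S x₁ ^ 2 * y ^ 2 ≤ S x₁ ^ 2 * (C * k ^ 2) :=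
    mul_le_mul_of_nonneg_left hfin (by positivity)
  have h3 : S x₁ ^ 2 * (C * k ^ 2) = C / R ^ 2 := by
    rw [hk]; field_simp
  linarith

/-- Entire version of `norm_gradient_sq_le_add_div`. -/
lemma rpow_norm_gradient_mul_exp_le {q b M : ℝ} (hn : 0 < n) (hq : 2 < q) (hb : 0 ≤ b)
    (hM : 0 < M) (hbM : n * q * b ≤ M) (hv : ContDiff ℝ 2 v)
    (hvf : ∀ x, elaplacian v x = -(‖gradient v x‖ ^ 2 +
      (‖gradient v x‖ ^ 2) ^ (q / 2) * Real.exp ((q - 2) / 2 * b * v x)))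
    (x : EuclideanSpace ℝ (Fin n)) :
    ‖gradient v x‖ ^ (q - 2) * Real.exp ((q - 2) / 2 * b * v x) ≤ M := by
  have hlim : Tendsto (fun R : ℝ => M ^ (2 / (q - 2)) * Real.exp (-b * v x) +
      (4 * n * (4 * n + 24) + 64 * n ^ 2 * q ^ 2) / R ^ 2) atTop
      (𝓝 (M ^ (2 / (q - 2)) * Real.exp (-b * v x) + 0)) :=
    tendsto_const_nhds.add (tendsto_const_nhds.div_atTop (tendsto_pow_atTop (by norm_num)))
  have hle : ‖gradient v x‖ ^ 2 ≤ M ^ (2 / (q - 2)) * Real.exp (-b * v x) := by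
    have := ge_of_tendsto hlim ((eventually_gt_atTop 0).mono fun R hR =>
      norm_gradient_sq_le_add_div hn hq hb hM hbM hv hvf x hR)
    simpa using this
  have h1 := Real.rpow_le_rpow (sq_nonneg _) hle (by linarith : 0 ≤ (q - 2) / 2)
  have h2 : 2 / (q - 2) * ((q - 2) / 2) = 1 := by
    have : q - 2 ≠ 0 := by linarith
    field_simp
  rw [Real.mul_rpow (Real.rpow_pos_of_pos hM _).le (Real.exp_pos _).le, ← Real.rpow_mul hM.le, h2,
    Real.rpow_one, ← Real.exp_mul, ← Real.rpow_natCast, ← Real.rpow_mul (norm_nonneg _),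
    show ((2 : ℕ) : ℝ) * ((q - 2) / 2) = q - 2 by push_cast; ring,
    show -b * v x * ((q - 2) / 2) = -((q - 2) / 2 * b * v x) by ring, Real.exp_neg,
    ← div_eq_mul_inv, le_div_iff₀ (Real.exp_pos _)] at h1
  exact h1

lemma gradient_log (hs : DifferentiableAt ℝ s x) (hx : s x ≠ 0) :
    gradient (fun y => Real.log (s y)) x = (s x)⁻¹ • gradient s x := by
  unfold gradient
  rw [(hs.hasFDerivAt.log hx).fderiv, map_smul]

end Laplacian

/-- **Corollary 2.5 (Euclidean case).** For `n ≥ 2`, `q > 2` and `p + q ≥ 1`, every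
positive classical solution of `Δu + |∇u|^q u^p = 0` on all of `ℝⁿ` satisfies
`|∇u|^(q−2) u^(p+1) ≤ 2nq(p+q−1)/(q−2)` everywhere. -/
theorem global_strong_control (n : ℕ) (hn : 2 ≤ n) (p q : ℝ) (hq : 2 < q)
    (hpq : 1 ≤ p + q)
    (u : EuclideanSpace ℝ (Fin n) → ℝ)
    (hu : ContDiff ℝ 2 u)
    (hpos : ∀ x, 0 < u x)
    (heq : ∀ x, elaplacian u x + ‖gradient u x‖ ^ q * u x ^ p = 0) :
    ∀ x, ‖gradient u x‖ ^ (q - 2) * u x ^ (p + 1)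
      ≤ 2 * (n : ℝ) * q * (p + q - 1) / (q - 2) := by
  intro x
  set a := p + q - 1 with ha
  have ha0 : 0 ≤ a := by linarith
  have hq2 : q - 2 ≠ 0 := by linarith
  set b := 2 * a / (q - 2) with hb
  have hb0 : 0 ≤ b := div_nonneg (by linarith) (by linarith)
  have hab : (q - 2) / 2 * b = a := by rw [hb]; field_simp
  have hv : ContDiff ℝ 2 fun y => Real.log (u y) := hu.log fun y => (hpos y).ne'
  have hgrad : ∀ y, ‖gradient (fun y => Real.log (u y)) y‖ = ‖gradient u y‖ / u y := fun y => by
    rw [gradient_log (hu.differentiable (by norm_num) y) (hpos y).ne', norm_smul, norm_inv,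
      Real.norm_of_nonneg (hpos y).le, inv_mul_eq_div]
  have hexp : ∀ y, Real.exp (a * Real.log (u y)) = u y ^ a := fun y => by
    rw [Real.rpow_def_of_pos (hpos y), mul_comm]
  have hvf : ∀ y, elaplacian (fun y => Real.log (u y)) y =
      -(‖gradient (fun y => Real.log (u y)) y‖ ^ 2 +
        (‖gradient (fun y => Real.log (u y)) y‖ ^ 2) ^ (q / 2) *
          Real.exp ((q - 2) / 2 * b * Real.log (u y))) := fun y => by
    have hy := hpos y
    have h1 : ∀ᶠ r in nhds (u y), HasDerivAt Real.log r⁻¹ r :=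
      (eventually_ne_nhds hy.ne').mono fun r hr => Real.hasDerivAt_log hr
    have h2 : ∀ r : ℝ, 0 ≤ r → (r ^ 2) ^ (q / 2) = r ^ q := fun r hr => by
      rw [← Real.rpow_natCast, ← Real.rpow_mul hr]
      congr 1
      push_cast
      ring
    rw [elaplacian_comp hu.contDiffAt h1 (hasDerivAt_inv hy.ne'), hgrad, hab, hexp,
      h2 _ (by positivity),
      Real.div_rpow (norm_nonneg _) hy.le, eq_neg_of_add_eq_zero_left (heq y),
      show a = p + q - 1 from ha, Real.rpow_sub_one hy.ne', Real.rpow_add hy]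
    have : u y ^ q ≠ 0 := (Real.rpow_pos_of_pos hy q).ne'
    field_simp
    ring
  have hux := hpos x
  have key : ‖gradient u x‖ ^ (q - 2) * u x ^ (p + 1) =
      ‖gradient (fun y => Real.log (u y)) x‖ ^ (q - 2) *
        Real.exp ((q - 2) / 2 * b * Real.log (u x)) := by
    rw [hgrad, hab, hexp, Real.div_rpow (norm_nonneg _) hux.le,
      show a = (p + 1) + (q - 2) by rw [ha]; ring, Real.rpow_add hux (p + 1)]
    have : u x ^ (q - 2) ≠ 0 := (Real.rpow_pos_of_pos hux _).ne'
    field_simp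
  rw [key]
  have hbound : 2 * (n : ℝ) * q * a / (q - 2) = n * q * b := by rw [hb]; ring
  rw [hbound]
  refine le_of_forall_pos_le_add fun ε hε => ?_
  have hnqb : 0 ≤ n * q * b := by positivity
  exact rpow_norm_gradient_mul_exp_le (by omega) hq hb0 (by linarith) (by linarith) hv hvf x
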